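/- Fix n₀ ≥ 1 and let f : ℕ → ℕ be such that (a) f(n) ≥ n for all n ≥ n₀, and (b) f(n+1) − f(n) > 0 for all n ≥ n₀. Then there is a strictly increasing function g : ℕ → ℕ such that (a) f(n) = g(n) for all sufficiently large n, and (b) P(G(f)) = P(G(g)). -/

import Mathlib

open Filter Asymptotics

/-- Membership in the grid `[-f n, f n]^2 ⊆ ℤ × ℤ`. -/
def inGrid (f : ℕ → ℕ) (n : ℕ) (p : ℤ × ℤ) : Prop :=
  |p.1| ≤ (f n : ℤ) ∧ |p.2| ≤ (f n : ℤ)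

instance (f : ℕ → ℕ) (n : ℕ) : DecidablePred (inGrid f n) := fun _ => by
  unfold inGrid; infer_instance

/-- The four lattice neighbours (at `L¹`-distance one) of a point. -/
def nbrs (p : ℤ × ℤ) : Finset (ℤ × ℤ) :=
  {(p.1 + 1, p.2), (p.1 - 1, p.2), (p.1, p.2 + 1), (p.1, p.2 - 1)}

/-- An activator sequence: whenever `V n ≠ ∅` (for `n ≥ 1`), the activated vertex
lies in the grid at time `n`. -/
def IsActivator (f : ℕ → ℕ) (V : ℕ → Option (ℤ × ℤ)) : Prop :=
  ∀ n, 1 ≤ n → ∀ p, V n = some p → inGrid f n p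

/-- The burning process: `B 0 = ∅`, and `B n` is obtained from `B (n-1)` by adding all
vertices of the grid at time `n` adjacent to a vertex of `B (n-1)`, and then adding
the activator `V n` if it is not `∅`. -/
def burnSet (f : ℕ → ℕ) (V : ℕ → Option (ℤ × ℤ)) : ℕ → Finset (ℤ × ℤ)
  | 0 => ∅
  | n + 1 =>
    let B := burnSet f V n
    let spread := B ∪ (B.biUnion nbrs).filter (inGrid f (n + 1))
    match V (n + 1) with
    | none => spread
    | some v => insert v spread

/-- The proportion `|B n| / |V(G n)|` of burning vertices at time `n`. -/
noncomputable def densitySeq (f : ℕ → ℕ) (V : ℕ → Option (ℤ × ℤ)) (n : ℕ) : ℝ :=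
  ((burnSet f V n).card : ℝ) / (2 * (f n : ℝ) + 1) ^ 2

/-- The lower burning density `δ̲(G(f), V)`. -/
noncomputable def lowerDensity (f : ℕ → ℕ) (V : ℕ → Option (ℤ × ℤ)) : ℝ :=
  liminf (densitySeq f V) atTop

/-- The upper burning density `δ̄(G(f), V)`. -/
noncomputable def upperDensity (f : ℕ → ℕ) (V : ℕ → Option (ℤ × ℤ)) : ℝ :=
  limsup (densitySeq f V) atTop

/-- The burning density of `V` in `G(f)` exists and equals `ρ`. -/
def HasBurningDensity (f : ℕ → ℕ) (V : ℕ → Option (ℤ × ℤ)) (ρ : ℝ) : Prop :=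
  Tendsto (densitySeq f V) atTop (nhds ρ)

/-- `P(G(f))`: the set of `ρ ∈ [0,1]` achievable as the burning density of some
non-empty activator sequence. -/
def densSet (f : ℕ → ℕ) : Set ℝ :=
  {ρ | ρ ∈ Set.Icc (0 : ℝ) 1 ∧
    ∃ V : ℕ → Option (ℤ × ℤ), IsActivator f V ∧ (∃ t, 1 ≤ t ∧ V t ≠ none) ∧
      HasBurningDensity f V ρ}

/-- The controlled growth requirement. -/
def ControlledGrowth (f : ℕ → ℕ) : Prop :=
  (∀ᶠ n in atTop, f n < f (n + 1)) ∧
  (∀ ε : ℕ → ℕ, (fun n => (ε n : ℝ)) =o[atTop] (fun n => (n : ℝ)) →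
    Tendsto (fun n => (f (n + ε n) : ℝ) / (f n : ℝ)) atTop (nhds 1)) ∧
  (∀ c : ℝ, 0 < c → ∃ d : ℝ, 0 < d ∧
    ∀ᶠ n in atTop, (1 + d) * (f n : ℝ) ≤ (f (n + ⌈c * n⌉₊) : ℝ))

theorem mem_burnSet_succ {f : ℕ → ℕ} {V : ℕ → Option (ℤ × ℤ)} {n : ℕ} {p : ℤ × ℤ} :
    p ∈ burnSet f V (n + 1) ↔ p ∈ burnSet f V n ∨
      (∃ q ∈ burnSet f V n, p ∈ nbrs q ∧ inGrid f (n + 1) p) ∨ V (n + 1) = some p := by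
  rw [burnSet]
  cases V (n + 1) with
  | none => simp only [Finset.mem_union, Finset.mem_filter, Finset.mem_biUnion]; grind
  | some v =>
    simp only [Finset.mem_insert, Finset.mem_union, Finset.mem_filter, Finset.mem_biUnion]
    grind

theorem burnSet_mono (f : ℕ → ℕ) (V : ℕ → Option (ℤ × ℤ)) : Monotone (burnSet f V) :=
  monotone_nat_of_le_succ fun _ _ hp => mem_burnSet_succ.2 (Or.inl hp)

theorem mem_burnSet_of_activator {f : ℕ → ℕ} {V : ℕ → Option (ℤ × ℤ)} {t : ℕ} {p : ℤ × ℤ}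
    (ht : 1 ≤ t) (hV : V t = some p) : p ∈ burnSet f V t := by
  obtain ⟨n, rfl⟩ := Nat.exists_eq_add_of_le' ht
  exact mem_burnSet_succ.2 (Or.inr (Or.inr hV))

theorem mem_nbrs_iff {p q : ℤ × ℤ} :
    p ∈ nbrs q ↔ (p.1 - q.1).natAbs + (p.2 - q.2).natAbs = 1 := by
  simp only [nbrs, Finset.mem_insert, Finset.mem_singleton, Prod.ext_iff]
  omega

theorem inGrid_iff {f : ℕ → ℕ} {n : ℕ} {p : ℤ × ℤ} :
    inGrid f n p ↔ p.1.natAbs ≤ f n ∧ p.2.natAbs ≤ f n := by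
  simp only [inGrid, Int.abs_eq_natAbs, Nat.cast_le]

/-- Once the grids at time `n` have radius at least `n`, fire spreads freely from a burning
vertex `q` in the `L¹`-ball of radius `k`. -/
theorem ball_subset_burnSet {f : ℕ → ℕ} {V : ℕ → Option (ℤ × ℤ)} {k : ℕ} {q : ℤ × ℤ}
    (hf : ∀ n, k ≤ n → n ≤ f n) (hq : q ∈ burnSet f V k)
    (hqk : q.1.natAbs + q.2.natAbs ≤ k) (j : ℕ) (p : ℤ × ℤ)
    (hp : (p.1 - q.1).natAbs + (p.2 - q.2).natAbs ≤ j) : p ∈ burnSet f V (k + j) := by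
  induction j generalizing p with
  | zero =>
    obtain rfl : p = q := Prod.ext (by omega) (by omega)
    exact hq
  | succ j ih =>
    by_cases hle : (p.1 - q.1).natAbs + (p.2 - q.2).natAbs ≤ j
    · exact burnSet_mono f V (Nat.le_succ _) (ih p hle)
    have hgrid : inGrid f (k + j + 1) p := by
      have := hf (k + j + 1) (by omega)
      rw [inGrid_iff]
      omega
    obtain ⟨p', hpp', hp'⟩ : ∃ p', p ∈ nbrs p' ∧
        (p'.1 - q.1).natAbs + (p'.2 - q.2).natAbs ≤ j := by
      simp only [mem_nbrs_iff]
      rcases lt_trichotomy p.1 q.1 with h | h | h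
      · exact ⟨(p.1 + 1, p.2), by simp, by dsimp only; omega⟩
      · rcases le_total p.2 q.2 with h' | h'
        · exact ⟨(p.1, p.2 + 1), by simp, by dsimp only; omega⟩
        · exact ⟨(p.1, p.2 - 1), by simp, by dsimp only; omega⟩
      · exact ⟨(p.1 - 1, p.2), by simp, by dsimp only; omega⟩
    exact mem_burnSet_succ.2 (Or.inr (Or.inl ⟨p', ih p' hp', hpp', hgrid⟩))

theorem exists_ball_subset_burnSet {f : ℕ → ℕ} {V : ℕ → Option (ℤ × ℤ)} {n₀ m : ℕ}
    (hf : ∀ n, n₀ ≤ n → n ≤ f n) (hne : (burnSet f V m).Nonempty) :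
    ∃ K : ℕ, ∀ n (p : ℤ × ℤ), p.1.natAbs + p.2.natAbs + K ≤ n → p ∈ burnSet f V n := by
  obtain ⟨q, hq⟩ := hne
  set k := m + n₀ + (q.1.natAbs + q.2.natAbs) with hk
  refine ⟨k + k, fun n p hp => ?_⟩
  have hn : n = k + (n - k) := by omega
  rw [hn]
  exact ball_subset_burnSet (fun n hn => hf n (by omega))
    (burnSet_mono f V (by omega : m ≤ k) hq) (by omega) _ _ (by omega)

/-- Two processes that agree after time `m` differ only within a ball of radius `n + O(1)`. -/
theorem exists_burnSet_subset_union_ball {f g : ℕ → ℕ} {V W : ℕ → Option (ℤ × ℤ)} {m : ℕ}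
    (hfg : ∀ n, m < n → f n = g n) (hVW : ∀ n, m < n → V n = W n) :
    ∃ K : ℕ, ∀ n, m ≤ n → ∀ p ∈ burnSet f V n,
      p ∈ burnSet g W n ∨ p.1.natAbs + p.2.natAbs ≤ n + K := by
  refine ⟨(burnSet f V m).sup fun p => p.1.natAbs + p.2.natAbs, fun n hn => ?_⟩
  induction n, hn using Nat.le_induction with
  | base =>
    intro p hp
    have := Finset.le_sup (f := fun p : ℤ × ℤ => p.1.natAbs + p.2.natAbs) hp
    exact Or.inr (this.trans (Nat.le_add_left _ _))
  | succ n hn ih =>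
    intro p hp
    rcases mem_burnSet_succ.1 hp with h | ⟨q, hq, hpq, hgrid⟩ | h
    · exact (ih p h).imp (fun h => burnSet_mono g W (Nat.le_succ n) h) (by omega)
    · rcases ih q hq with h | h
      · refine Or.inl (mem_burnSet_succ.2 (Or.inr (Or.inl ⟨q, h, hpq, ?_⟩)))
        rwa [inGrid_iff, hfg _ (by omega), ← inGrid_iff] at hgrid
      · rw [mem_nbrs_iff] at hpq
        exact Or.inr (by omega)
    · exact Or.inl (mem_burnSet_succ.2 (Or.inr (Or.inr (hVW (n + 1) (by omega) ▸ h))))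

theorem burnSet_congr {f g : ℕ → ℕ} {V : ℕ → Option (ℤ × ℤ)} {n₀ : ℕ}
    (hfg : ∀ n, n₀ ≤ n → f n = g n) (hV : ∀ t, 1 ≤ t → t < n₀ → V t = none) (n : ℕ) :
    burnSet f V n = burnSet g V n := by
  have hempty : ∀ (h : ℕ → ℕ) n, n < n₀ → burnSet h V n = ∅ := by
    intro h n hn
    induction n with
    | zero => rfl
    | succ n ih => simp [burnSet, hV (n + 1) (by omega) hn, ih (by omega)]
  induction n with
  | zero => rfl
  | succ n ih =>
    by_cases hn : n + 1 < n₀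
    · rw [hempty f _ hn, hempty g _ hn]
    · ext p
      rw [mem_burnSet_succ, mem_burnSet_succ, ih]
      simp only [inGrid_iff, hfg (n + 1) (by omega)]

/-- An annulus in the `L¹`-norm of bounded width has linearly many lattice points. -/
theorem card_le_of_subset_annulus {n K : ℕ} {S : Finset (ℤ × ℤ)}
    (hS : ∀ p ∈ S, n < p.1.natAbs + p.2.natAbs + K ∧ p.1.natAbs + p.2.natAbs ≤ n + K) :
    S.card ≤ (2 * (n + K) + 1) * (2 * K * 2) := by
  let T : Finset (ℤ × ℤ × Bool) :=
    Finset.Icc (-(n + K : ℤ)) (n + K) ×ˢ Finset.Ioc (n - K : ℤ) (n + K) ×ˢ Finset.univ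
  have hT : T.card = (2 * (n + K) + 1) * (2 * K * 2) := by
    simp only [T, Finset.card_product, Int.card_Icc, Int.card_Ioc, Finset.card_univ,
      Fintype.card_bool]
    congr 1
    · omega
    · congr 1
      omega
  rw [← hT]
  refine Finset.card_le_card_of_injOn
    (fun p => (p.1, (p.1.natAbs + p.2.natAbs : ℤ), decide (0 ≤ p.2))) ?_ ?_
  · intro p hp
    have := hS p hp
    simp only [T, Finset.coe_product, Set.mem_prod, Finset.mem_coe, Finset.mem_Icc,
      Finset.mem_Ioc, Finset.mem_univ, and_true]
    omega
  · intro p _ q _ h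
    simp only [Prod.mk.injEq, decide_eq_decide] at h
    exact Prod.ext h.1 (by omega)

theorem tendsto_densitySeq_of_card_sub_le {f g : ℕ → ℕ} {V W : ℕ → Option (ℤ × ℤ)} {ρ : ℝ}
    {n₀ M : ℕ} (hfg : ∀ n, n₀ ≤ n → f n = g n) (hf : ∀ n, n₀ ≤ n → n ≤ f n)
    (hVW : ∀ n, n₀ ≤ n → (burnSet f V n \ burnSet g W n).card ≤ M * (2 * n + 1))
    (hWV : ∀ n, n₀ ≤ n → (burnSet g W n \ burnSet f V n).card ≤ M * (2 * n + 1))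
    (hV : HasBurningDensity f V ρ) : HasBurningDensity g W ρ := by
  have hlim : Tendsto (fun n : ℕ => (M : ℝ) / (2 * n + 1)) atTop (nhds 0) :=
    Tendsto.div_atTop tendsto_const_nhds <| tendsto_atTop_add_const_right _ _ <|
      tendsto_natCast_atTop_atTop.const_mul_atTop two_pos
  have hdiff : Tendsto (fun n => densitySeq g W n - densitySeq f V n) atTop (nhds 0) := by
    refine squeeze_zero_norm' ?_ hlim
    filter_upwards [eventually_ge_atTop n₀] with n hn
    have h₁ : (burnSet f V n).card ≤ (burnSet g W n).card + M * (2 * n + 1) := by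
      have := Finset.le_card_sdiff (burnSet g W n) (burnSet f V n)
      have := hVW n hn
      omega
    have h₂ : (burnSet g W n).card ≤ (burnSet f V n).card + M * (2 * n + 1) := by
      have := Finset.le_card_sdiff (burnSet f V n) (burnSet g W n)
      have := hWV n hn
      omega
    have h₁' : ((burnSet f V n).card : ℝ) ≤ (burnSet g W n).card + M * (2 * n + 1) := by
      exact_mod_cast h₁
    have h₂' : ((burnSet g W n).card : ℝ) ≤ (burnSet f V n).card + M * (2 * n + 1) := by
      exact_mod_cast h₂
    have hfn : (n : ℝ) ≤ g n := by exact_mod_cast hfg n hn ▸ hf n hn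
    have hpos : (0 : ℝ) < 2 * n + 1 := by positivity
    rw [densitySeq, densitySeq, hfg n hn, ← sub_div, Real.norm_eq_abs, abs_div,
      abs_of_pos (by positivity : (0 : ℝ) < (2 * (g n : ℝ) + 1) ^ 2)]
    calc |((burnSet g W n).card : ℝ) - (burnSet f V n).card| / (2 * (g n : ℝ) + 1) ^ 2
        ≤ ((M : ℝ) * (2 * n + 1)) / (2 * (n : ℝ) + 1) ^ 2 := by
          gcongr
          exact abs_sub_le_iff.2 ⟨by linarith, by linarith⟩
      _ = (M : ℝ) / (2 * n + 1) := by field_simp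
  simpa [HasBurningDensity] using hV.add hdiff

theorem densSet_subset_of_eventuallyEq {f g : ℕ → ℕ} {n₀ : ℕ}
    (hf : ∀ n, n₀ ≤ n → n ≤ f n) (hfg : ∀ n, n₀ ≤ n → f n = g n) :
    densSet f ⊆ densSet g := by
  rintro ρ ⟨hρ, V, hact, hne, hdens⟩
  refine ⟨hρ, ?_⟩
  by_cases hearly : ∀ t, 1 ≤ t → t < n₀ → V t = none
  · refine ⟨V, fun n hn p hp => ?_, hne,
      tendsto_densitySeq_of_card_sub_le (M := 0) hfg hf ?_ ?_ hdens⟩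
    · have hn₀ : n₀ ≤ n := by
        by_contra! h
        simp [hearly n hn h] at hp
      have := hact n hn p hp
      rwa [inGrid_iff, hfg n hn₀, ← inGrid_iff] at this
    all_goals simp [burnSet_congr hfg hearly]
  push Not at hearly
  obtain ⟨t, ht, htn, hVt⟩ := hearly
  obtain ⟨v, hv⟩ := Option.ne_none_iff_exists'.1 hVt
  -- All activations before time `n₀` are replaced by a single one, at the origin.
  let W : ℕ → Option (ℤ × ℤ) := fun t => if n₀ ≤ t then V t else if t = 1 then some 0 else none
  have hW : ∀ n, n₀ ≤ n → V n = W n := fun n hn => by simp [W, hn]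
  have hW₁ : W 1 = some 0 := by simp [W, show ¬ n₀ ≤ 1 by omega]
  have hg : ∀ n, n₀ ≤ n → n ≤ g n := fun n hn => hfg n hn ▸ hf n hn
  obtain ⟨K₁, hK₁⟩ := exists_ball_subset_burnSet hf ⟨v, mem_burnSet_of_activator ht hv⟩
  obtain ⟨K₂, hK₂⟩ := exists_ball_subset_burnSet hg ⟨0, mem_burnSet_of_activator le_rfl hW₁⟩
  obtain ⟨L₁, hL₁⟩ := exists_burnSet_subset_union_ball (m := n₀)
    (fun n hn => hfg n hn.le) (fun n hn => hW n hn.le)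
  obtain ⟨L₂, hL₂⟩ := exists_burnSet_subset_union_ball (m := n₀)
    (fun n hn => (hfg n hn.le).symm) (fun n hn => (hW n hn.le).symm)
  set K := K₁ + K₂ + L₁ + L₂ with hK
  have hcard : ∀ {n : ℕ}, (2 * (n + K) + 1) * (2 * K * 2) ≤
      (2 * K + 1) * (2 * K * 2) * (2 * n + 1) := by
    intro n
    have : 2 * (n + K) + 1 ≤ (2 * K + 1) * (2 * n + 1) := by nlinarith [Nat.zero_le (K * n)]
    calc _ ≤ (2 * K + 1) * (2 * n + 1) * (2 * K * 2) := Nat.mul_le_mul_right _ this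
      _ = _ := by ring
  refine ⟨W, fun n hn p hp => ?_, ⟨1, le_rfl, by simp [hW₁]⟩,
    tendsto_densitySeq_of_card_sub_le (n₀ := n₀) hfg hf
      (fun n hn => (card_le_of_subset_annulus (K := K) fun p hp => ?_).trans hcard)
      (fun n hn => (card_le_of_subset_annulus (K := K) fun p hp => ?_).trans hcard) hdens⟩
  · by_cases hn₀ : n₀ ≤ n
    · have := hact n hn p ((hW n hn₀).trans hp)
      rwa [inGrid_iff, hfg n hn₀, ← inGrid_iff] at this
    · simp only [W, hn₀, if_false, Option.ite_none_right_eq_some, Option.some.injEq] at hp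
      simp [inGrid, ← hp.2]
  · obtain ⟨hpV, hpW⟩ := Finset.mem_sdiff.1 hp
    have h₁ := mt (hK₂ n p) hpW
    have h₂ := (hL₁ n hn p hpV).resolve_left hpW
    omega
  · obtain ⟨hpW, hpV⟩ := Finset.mem_sdiff.1 hp
    have h₁ := mt (hK₁ n p) hpV
    have h₂ := (hL₂ n hn p hpW).resolve_left hpV
    omega

/-- if `f(n) ≥ n` and `f(n+1) > f(n)` for all `n ≥ n₀`, then there is a
strictly increasing `g` agreeing with `f` for all sufficiently large `n` and with
`P(G(f)) = P(G(g))`. -/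
theorem eventually_strictMono_replacement (n₀ : ℕ) (hn₀ : 1 ≤ n₀) (f : ℕ → ℕ)
    (ha : ∀ n, n₀ ≤ n → n ≤ f n)
    (hb : ∀ n, n₀ ≤ n → f n < f (n + 1)) :
    ∃ g : ℕ → ℕ, StrictMono g ∧ (∀ᶠ n in atTop, f n = g n) ∧
      densSet f = densSet g := by
  set g : ℕ → ℕ := fun n => if n₀ ≤ n then f n else n with hg
  have hfg : ∀ n, n₀ ≤ n → f n = g n := fun n hn => by simp [hg, hn]
  refine ⟨g, strictMono_nat_of_lt_succ fun n => ?_, eventually_atTop.2 ⟨n₀, hfg⟩,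
    (densSet_subset_of_eventuallyEq ha hfg).antisymm
      (densSet_subset_of_eventuallyEq (fun n hn => hfg n hn ▸ ha n hn)
        fun n hn => (hfg n hn).symm)⟩
  have h₁ := ha (n + 1)
  have h₂ := hb n
  simp only [hg]
  split_ifs <;> omega
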